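/- Fix s>0, N∈ℕ, 0≤ρ_l<ρ_r<∞ and h∈ℝ^N with h_i < log(1+1/ρ_r) for all i. Then the moment generating function of the mixture measure satisfies Σ_{η∈ℕ^N} μ_{N,ρ_l,ρ_r}(η) ∏_{i=1}^{N} e^{h_i η_i} = [Γ(2s(N+1)) / (Γ(2s)^{N+1}(ρ_r−ρ_l)^{2s(N+1)−1})] · ∫_{ρ_l}^{ρ_r}dθ_1 ∫_{θ_1}^{ρ_r}dθ_2 ⋯ ∫_{θ_{N−1}}^{ρ_r}dθ_N ∏_{i=1}^{N+1}(θ_i−θ_{i−1})^{2s−1} · ∏_{i=1}^{N}(1+θ_i(1−e^{h_i}))^{−2s}, with conventions θ_0=ρ_l, θ_{N+1}=ρ_r, and the series on the left converges absolutely. -/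

import Mathlib

/-- The ordered simplex `{θ : ρ_l ≤ θ_1 ≤ θ_2 ≤ … ≤ θ_N ≤ ρ_r}`, the region of the nested
integral `∫_{ρ_l}^{ρ_r}dθ_1 ∫_{θ_1}^{ρ_r}dθ_2 ⋯ ∫_{θ_{N−1}}^{ρ_r}dθ_N`. -/
def simplexSet (N : ℕ) (ρl ρr : ℝ) : Set (Fin N → ℝ) :=
  {θ | (∀ i j : Fin N, i ≤ j → θ i ≤ θ j) ∧ ∀ i, ρl ≤ θ i ∧ θ i ≤ ρr}

/-- The extended chain `(θ_0, θ_1, …, θ_N, θ_{N+1})` with the conventions `θ_0 = ρ_l`,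
`θ_{N+1} = ρ_r`. -/
noncomputable def chainExt (ρl ρr : ℝ) {N : ℕ} (θ : Fin N → ℝ) : Fin (N + 2) → ℝ :=
  Fin.snoc (Fin.cons ρl θ) ρr

/-- The product of the consecutive gaps: `∏_{i=1}^{N+1} (θ_i − θ_{i−1})^{2s−1}` with the
conventions `θ_0 = ρ_l`, `θ_{N+1} = ρ_r`. -/
noncomputable def gapProd (s ρl ρr : ℝ) {N : ℕ} (θ : Fin N → ℝ) : ℝ :=
  ∏ i : Fin (N + 1),
    (chainExt ρl ρr θ i.succ - chainExt ρl ρr θ i.castSucc) ^ (2 * s - 1)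

/-- The Negative Binomial probability mass function with shape parameter `2s` and scale `θ`:
`ν_θ(m) = (Γ(2s+m)/(m!·Γ(2s)))·(θ/(1+θ))^m·(1+θ)^{−2s}`. -/
noncomputable def negBin (s θ : ℝ) (m : ℕ) : ℝ :=
  (Real.Gamma (2 * s + (m : ℝ)) / ((m.factorial : ℝ) * Real.Gamma (2 * s)))
    * (θ / (1 + θ)) ^ m * (1 + θ) ^ (-(2 * s))

/-- The mixture measure (non-equilibrium steady state of the open harmonic process):
`μ_{N,ρ_l,ρ_r}(η) = [Γ(2s(N+1))/(Γ(2s)^{N+1}(ρ_r−ρ_l)^{2s(N+1)−1})] ·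
∫_{ρ_l}^{ρ_r}dθ_1 ⋯ ∫_{θ_{N−1}}^{ρ_r}dθ_N ∏_{i=1}^{N+1}(θ_i−θ_{i−1})^{2s−1}·∏_{i=1}^{N}ν_{θ_i}(η_i)`,
with `θ_0 = ρ_l`, `θ_{N+1} = ρ_r`, the nested integral being the integral over the ordered
simplex. -/
noncomputable def mixtureMeasure (s ρl ρr : ℝ) (N : ℕ) (η : Fin N → ℕ) : ℝ :=
  (Real.Gamma (2 * s * ((N : ℝ) + 1)) /
      (Real.Gamma (2 * s) ^ (N + 1) * (ρr - ρl) ^ (2 * s * ((N : ℝ) + 1) - 1))) *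
    ∫ θ in simplexSet N ρl ρr,
      gapProd s ρl ρr θ * ∏ i : Fin N, negBin s (θ i) (η i)

section MixtureMeasureMGF

open MeasureTheory Set

theorem HasSum.mul_of_nonneg {ι κ : Type*} {f : ι → ℝ} {g : κ → ℝ} {a b : ℝ}
    (hf : HasSum f a) (hg : HasSum g b) (hf0 : ∀ i, 0 ≤ f i) (hg0 : ∀ k, 0 ≤ g k) :
    HasSum (fun p : ι × κ => f p.1 * g p.2) (a * b) :=
  hf.mul hg (hf.summable.mul_of_nonneg hg.summable hf0 hg0)

theorem hasSum_pi_prod_of_nonneg {N : ℕ} {f : Fin N → ℕ → ℝ} {a : Fin N → ℝ}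
    (hf : ∀ i m, 0 ≤ f i m) (hfa : ∀ i, HasSum (f i) (a i)) :
    HasSum (fun η : Fin N → ℕ => ∏ i, f i (η i)) (∏ i, a i) := by
  induction N with
  | zero => simp
  | succ N ih =>
    have hsum := (hfa 0).mul_of_nonneg (ih (fun i m => hf i.succ m) fun i => hfa i.succ) (hf 0)
      fun η => Finset.prod_nonneg fun i _ => hf i.succ (η i)
    rw [← (Fin.consEquiv (fun _ : Fin (N + 1) => ℕ)).hasSum_iff, Fin.prod_univ_succ]
    convert! hsum using 2 with p
    simp [Fin.prod_univ_succ, Fin.consEquiv]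

theorem Real.Gamma_add_nat_div_eq_multichoose {a : ℝ} (ha : 0 < a) (n : ℕ) :
    Real.Gamma (a + n) / (n.factorial * Real.Gamma a) = Ring.multichoose a n := by
  have hG : Real.Gamma (a + n) = (ascPochhammer ℝ n).eval a * Real.Gamma a := by
    induction n with
    | zero => simp
    | succ n ih =>
      rw [Nat.cast_succ, ← add_assoc, Real.Gamma_add_one (by positivity), ih,
        ascPochhammer_succ_eval]
      ring
  have hm := Ring.factorial_nsmul_multichoose_eq_ascPochhammer a n
  rw [Polynomial.ascPochhammer_smeval_eq_eval, nsmul_eq_mul] at hm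
  rw [hG, ← hm]
  have := (Real.Gamma_pos_of_pos ha).ne'
  field_simp

theorem hasSum_negativeBinomial {a x : ℝ} (ha : 0 < a) (hx0 : 0 ≤ x) (hx1 : x < 1) :
    HasSum (fun n : ℕ => Real.Gamma (a + n) / (n.factorial * Real.Gamma a) * x ^ n)
      ((1 - x) ^ (-a)) := by
  have h := (Real.one_div_one_sub_rpow_hasFPowerSeriesOnBall_zero a).hasSum
    (y := x) (by simpa [Metric.mem_eball, edist_dist, abs_of_nonneg hx0] using hx1)
  simp only [FormalMultilinearSeries.ofScalars_apply_eq, zero_add, smul_eq_mul] at h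
  rw [Real.rpow_neg (by linarith), ← one_div]
  convert! h using 2 with n
  rw [Real.Gamma_add_nat_div_eq_multichoose ha, Ring.choose]
  congr 2
  ring

theorem lintegral_Ioo_rpow_mul_rpow {α β : ℝ} (hα : 0 < α) (hβ : 0 < β) {a b : ℝ} (hab : a < b) :
    ∫⁻ t in Ioo a b, ENNReal.ofReal ((t - a) ^ (α - 1) * (b - t) ^ (β - 1)) =
      ENNReal.ofReal (ProbabilityTheory.beta α β * (b - a) ^ (α + β - 1)) := by
  have hL : 0 < b - a := sub_pos.2 hab
  have hB := ProbabilityTheory.beta_pos hα hβ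
  have himg : (fun x : ℝ => (b - a) * x + a) '' Ioo 0 1 = Ioo a b := by
    rw [image_affine_Ioo hL]
    simp
  rw [← himg, lintegral_image_eq_lintegral_abs_deriv_mul (f' := fun _ => b - a) measurableSet_Ioo
    (fun x _ => by simpa using (((hasDerivAt_id x).const_mul (b - a)).add_const a).hasDerivWithinAt)
    (fun x _ y _ hxy => by simpa [hL.ne'] using hxy)]
  have h1 := ProbabilityTheory.lintegral_betaPDF_eq_one hα hβ
  rw [ProbabilityTheory.lintegral_betaPDF] at h1
  rw [← mul_one (ENNReal.ofReal (_ * _)), ← h1, ← lintegral_const_mul' _ _ ENNReal.ofReal_ne_top]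
  refine setLIntegral_congr_fun measurableSet_Ioo fun x hx => ?_
  have hx0 : 0 < x := hx.1
  have hx1 : 0 < 1 - x := by linarith [hx.2]
  rw [← ENNReal.ofReal_mul (by positivity), ← ENNReal.ofReal_mul (by positivity), abs_of_pos hL,
    add_sub_cancel_right, show b - ((b - a) * x + a) = (b - a) * (1 - x) by ring,
    Real.mul_rpow hL.le hx0.le, Real.mul_rpow hL.le hx1.le,
    show α + β - 1 = 1 + (α - 1) + (β - 1) by ring, Real.rpow_add hL, Real.rpow_add hL,
    Real.rpow_one]
  congr 1
  field_simp

theorem isClosed_simplexSet (N : ℕ) (a b : ℝ) : IsClosed (simplexSet N a b) := by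
  simp only [simplexSet, ofPred_and, ofPred_forall]
  refine IsClosed.inter ?_ ?_
  · exact isClosed_iInter fun i => isClosed_iInter fun j => isClosed_iInter fun _ =>
      isClosed_le (by fun_prop) (by fun_prop)
  · exact isClosed_iInter fun i => (isClosed_le (by fun_prop) (by fun_prop)).inter
      (isClosed_le (by fun_prop) (by fun_prop))

theorem mem_Icc_and_mem_simplexSet_of_cons {N : ℕ} {a b t : ℝ} {θ : Fin N → ℝ}
    (h : (Fin.cons t θ : Fin (N + 1) → ℝ) ∈ simplexSet (N + 1) a b) :
    t ∈ Icc a b ∧ θ ∈ simplexSet N t b := by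
  refine ⟨by simpa using h.2 0, fun i j hij => ?_, fun i => ⟨?_, ?_⟩⟩
  · simpa using h.1 i.succ j.succ (by simpa using hij)
  · simpa using h.1 0 i.succ (Fin.zero_le _)
  · simpa using (h.2 i.succ).2

theorem gapProd_cons (s a b t : ℝ) {N : ℕ} (θ : Fin N → ℝ) :
    gapProd s a b (Fin.cons t θ : Fin (N + 1) → ℝ) =
      (t - a) ^ (2 * s - 1) * gapProd s t b θ := by
  have hchain : chainExt a b (Fin.cons t θ : Fin (N + 1) → ℝ) =
      (Fin.cons a (chainExt t b θ) : Fin (N + 3) → ℝ) := by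
    simp only [chainExt]
    exact (Fin.cons_snoc_eq_snoc_cons a (Fin.cons t θ : Fin (N + 1) → ℝ) b).symm
  have hzero : chainExt t b θ 0 = t := by
    simp only [chainExt]
    rw [← Fin.castSucc_zero, Fin.snoc_castSucc, Fin.cons_zero]
  unfold gapProd
  rw [Fin.prod_univ_succ, hchain]
  simp [hzero]

theorem gapProd_nonneg (s : ℝ) {N : ℕ} {a b : ℝ} (hab : a ≤ b) {θ : Fin N → ℝ}
    (hθ : θ ∈ simplexSet N a b) : 0 ≤ gapProd s a b θ := by
  induction N generalizing a with
  | zero =>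
    simpa [gapProd, chainExt, Fin.snoc] using Real.rpow_nonneg (sub_nonneg.2 hab) (2 * s - 1)
  | succ N ih =>
    obtain ⟨t, θ, rfl⟩ : ∃ t θ', θ = (Fin.cons t θ' : Fin (N + 1) → ℝ) :=
      ⟨θ 0, Fin.tail θ, (Fin.cons_self_tail θ).symm⟩
    obtain ⟨ht, hθ'⟩ := mem_Icc_and_mem_simplexSet_of_cons hθ
    rw [gapProd_cons]
    exact mul_nonneg (Real.rpow_nonneg (sub_nonneg.2 ht.1) _) (ih ht.2 hθ')

theorem measurable_gapProd (s a b : ℝ) (N : ℕ) :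
    Measurable (fun θ : Fin N → ℝ => gapProd s a b θ) := by
  have hchain : ∀ j : Fin (N + 2), Measurable fun θ : Fin N → ℝ => chainExt a b θ j := by
    intro j
    unfold chainExt
    induction j using Fin.lastCases with
    | last => simp
    | cast j =>
      simp only [Fin.snoc_castSucc]
      induction j using Fin.cases with
      | zero => simp
      | succ j => simpa using measurable_pi_apply j
  exact Finset.measurable_fun_prod _ fun i _ =>
    ((hchain _).sub (hchain _)).pow_const _

theorem exists_setLIntegral_gapProd_le {s : ℝ} (hs : 0 < s) (N : ℕ) (b : ℝ) :
    ∃ C : ℝ, 0 ≤ C ∧ ∀ a < b,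
      ∫⁻ θ in simplexSet N a b, ENNReal.ofReal (gapProd s a b θ) ≤
        ENNReal.ofReal (C * (b - a) ^ (2 * s * (N + 1) - 1)) := by
  induction N with
  | zero =>
    refine ⟨1, zero_le_one, fun a _ => (setLIntegral_le_lintegral _ _).trans ?_⟩
    simp [gapProd, chainExt, volume_pi, Fin.snoc]
  | succ N ih =>
    obtain ⟨C, hC, hle⟩ := ih
    have hα : 0 < 2 * s := by positivity
    have hβ : 0 < 2 * s * (N + 1) := by positivity
    refine ⟨C * ProbabilityTheory.beta (2 * s) (2 * s * (N + 1)),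
      mul_nonneg hC (ProbabilityTheory.beta_pos hα hβ).le, fun a hab => ?_⟩
    rw [← lintegral_indicator (isClosed_simplexSet _ _ _).measurableSet,
      ← (volume_preserving_piFinSuccAbove (fun _ : Fin (N + 1) => ℝ) 0).symm.lintegral_comp_emb
        (MeasurableEquiv.measurableEmbedding _)]
    calc _ ≤ ∫⁻ t, ∫⁻ θ : Fin N → ℝ, (simplexSet (N + 1) a b).indicator
            (fun θ => ENNReal.ofReal (gapProd s a b θ)) (Fin.cons t θ : Fin (N + 1) → ℝ) := by
          refine (lintegral_prod_le _).trans (le_of_eq ?_)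
          simp [MeasurableEquiv.piFinSuccAbove_symm_apply, Fin.insertNthEquiv]
      _ ≤ ∫⁻ t, (Ioo a b).indicator (fun t => ENNReal.ofReal C *
            ENNReal.ofReal ((t - a) ^ (2 * s - 1) * (b - t) ^ (2 * s * (N + 1) - 1))) t := by
          refine lintegral_mono_ae ?_
          filter_upwards [Measure.ae_ne volume a, Measure.ae_ne volume b] with t hta htb
          by_cases ht : t ∈ Ioo a b
          · have hta' : 0 ≤ (t - a) ^ (2 * s - 1) := Real.rpow_nonneg (sub_nonneg.2 ht.1.le) _
            rw [indicator_of_mem ht]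
            calc _ ≤ ∫⁻ θ : Fin N → ℝ, ENNReal.ofReal ((t - a) ^ (2 * s - 1)) *
                    (simplexSet N t b).indicator
                      (fun θ => ENNReal.ofReal (gapProd s t b θ)) θ := by
                  refine lintegral_mono fun θ => ?_
                  by_cases h : (Fin.cons t θ : Fin (N + 1) → ℝ) ∈ simplexSet (N + 1) a b
                  · rw [indicator_of_mem h,
                      indicator_of_mem (mem_Icc_and_mem_simplexSet_of_cons h).2, gapProd_cons,
                      ENNReal.ofReal_mul hta']
                  · rw [indicator_of_notMem h]
                    exact zero_le
              _ = ENNReal.ofReal ((t - a) ^ (2 * s - 1)) *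
                    ∫⁻ θ in simplexSet N t b, ENNReal.ofReal (gapProd s t b θ) := by
                  rw [lintegral_const_mul' _ _ ENNReal.ofReal_ne_top,
                    lintegral_indicator (isClosed_simplexSet _ _ _).measurableSet]
              _ ≤ _ := by
                  grw [hle t ht.2]
                  rw [← ENNReal.ofReal_mul hta', ← ENNReal.ofReal_mul hC, mul_left_comm]
          · rw [indicator_of_notMem ht, nonpos_iff_eq_zero]
            refine (lintegral_congr fun θ => indicator_of_notMem (fun h => ht ?_) _).trans
              lintegral_zero
            have h' := (mem_Icc_and_mem_simplexSet_of_cons h).1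
            exact ⟨h'.1.lt_of_ne' hta, h'.2.lt_of_ne htb⟩
      _ = _ := by
          rw [lintegral_indicator measurableSet_Ioo,
            lintegral_const_mul' _ _ ENNReal.ofReal_ne_top, lintegral_Ioo_rpow_mul_rpow hα hβ hab,
            ← ENNReal.ofReal_mul hC]
          push_cast
          ring_nf

theorem integrableOn_gapProd {s : ℝ} (hs : 0 < s) (N : ℕ) {a b : ℝ} (hab : a < b) :
    IntegrableOn (fun θ : Fin N → ℝ => gapProd s a b θ) (simplexSet N a b) := by
  obtain ⟨C, -, hC⟩ := exists_setLIntegral_gapProd_le hs N b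
  refine ⟨(measurable_gapProd s a b N).aestronglyMeasurable, ?_⟩
  rw [hasFiniteIntegral_iff_ofReal]
  · exact (hC a hab).trans_lt ENNReal.ofReal_lt_top
  · exact (ae_restrict_mem (isClosed_simplexSet N a b).measurableSet).mono
      fun θ hθ => gapProd_nonneg s hab.le hθ

theorem isCompact_simplexSet (N : ℕ) (a b : ℝ) : IsCompact (simplexSet N a b) :=
  (isCompact_Icc (a := fun _ : Fin N => a) (b := fun _ => b)).of_isClosed_subset
    (isClosed_simplexSet N a b) fun _ hθ => ⟨fun i => (hθ.2 i).1, fun i => (hθ.2 i).2⟩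

theorem negBin_nonneg {s θ : ℝ} (hs : 0 < s) (hθ : 0 ≤ θ) (m : ℕ) : 0 ≤ negBin s θ m := by
  have hG : 0 < Real.Gamma (2 * s) := Real.Gamma_pos_of_pos (by positivity)
  have hGm : 0 < Real.Gamma (2 * s + m) := Real.Gamma_pos_of_pos (by positivity)
  unfold negBin
  positivity

theorem measurable_negBin (s : ℝ) (m : ℕ) : Measurable fun θ : ℝ => negBin s θ m := by
  unfold negBin
  fun_prop

theorem hasSum_negBin_mul_exp {s θ h : ℝ} (hs : 0 < s) (hθ : 0 ≤ θ)
    (hpos : 0 < 1 + θ * (1 - Real.exp h)) :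
    HasSum (fun m : ℕ => negBin s θ m * Real.exp (h * m))
      ((1 + θ * (1 - Real.exp h)) ^ (-(2 * s))) := by
  have hθ1 : 0 < 1 + θ := by positivity
  have hx1 : θ * Real.exp h / (1 + θ) < 1 := by
    rw [div_lt_one hθ1]
    linarith
  have hsum := (hasSum_negativeBinomial (a := 2 * s) (by positivity)
    (by positivity : 0 ≤ θ * Real.exp h / (1 + θ)) hx1).mul_right ((1 + θ) ^ (-(2 * s)))
  rw [← Real.mul_rpow (by linarith) hθ1.le,
    show (1 - θ * Real.exp h / (1 + θ)) * (1 + θ) = 1 + θ * (1 - Real.exp h) by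
      field_simp
      ring] at hsum
  convert! hsum using 2 with m
  rw [negBin, mul_comm h, Real.exp_nat_mul, mul_div_right_comm, mul_pow]
  ring

theorem one_add_mul_one_sub_exp_pos {θ ρ h : ℝ} (hθ : 0 ≤ θ) (hθρ : θ ≤ ρ) (hρ : 0 < ρ)
    (hh : h < Real.log (1 + 1 / ρ)) : 0 < 1 + θ * (1 - Real.exp h) := by
  have hexp : Real.exp h < 1 + 1 / ρ := (Real.lt_log_iff_exp_lt (by positivity)).1 hh
  rcases hθ.eq_or_lt with rfl | hθ
  · simp
  · have hρθ : θ * (1 / ρ) ≤ 1 := by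
      rw [mul_one_div]
      exact (div_le_one hρ).2 hθρ
    nlinarith

theorem hasSum_setIntegral_gapProd_mul_negBin {s : ℝ} (hs : 0 < s) {N : ℕ} {a b : ℝ}
    (ha : 0 ≤ a) (hab : a < b) {h : Fin N → ℝ} (hh : ∀ i, h i < Real.log (1 + 1 / b)) :
    HasSum (fun η : Fin N → ℕ =>
        (∫ θ in simplexSet N a b, gapProd s a b θ * ∏ i, negBin s (θ i) (η i)) *
          ∏ i, Real.exp (h i * η i))
      (∫ θ in simplexSet N a b,
        gapProd s a b θ * ∏ i, (1 + θ i * (1 - Real.exp (h i))) ^ (-(2 * s))) := by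
  have hmem := ae_restrict_mem (μ := volume) (isClosed_simplexSet N a b).measurableSet
  have hpos : ∀ θ ∈ simplexSet N a b, ∀ i, 0 < 1 + θ i * (1 - Real.exp (h i)) := fun θ hθ i =>
    one_add_mul_one_sub_exp_pos (ha.trans (hθ.2 i).1) (hθ.2 i).2 (ha.trans_lt hab) (hh i)
  have hterm : ∀ θ ∈ simplexSet N a b, HasSum
      (fun η : Fin N → ℕ => gapProd s a b θ * (∏ i, negBin s (θ i) (η i)) *
        ∏ i, Real.exp (h i * η i))
      (gapProd s a b θ * ∏ i, (1 + θ i * (1 - Real.exp (h i))) ^ (-(2 * s))) := by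
    intro θ hθ
    simp only [mul_assoc (gapProd s a b θ), ← Finset.prod_mul_distrib]
    exact (hasSum_pi_prod_of_nonneg
      (fun i m => mul_nonneg (negBin_nonneg hs (ha.trans (hθ.2 i).1) m) (Real.exp_pos _).le)
      fun i => hasSum_negBin_mul_exp hs (ha.trans (hθ.2 i).1) (hpos θ hθ i)).mul_left _
  have hint : IntegrableOn (fun θ : Fin N → ℝ =>
      gapProd s a b θ * ∏ i, (1 + θ i * (1 - Real.exp (h i))) ^ (-(2 * s)))
      (simplexSet N a b) := by
    refine (integrableOn_gapProd hs N hab).mul_continuousOn ?_ (isCompact_simplexSet N a b)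
    exact continuousOn_finsetProd _ fun i _ =>
      ContinuousOn.rpow_const (by fun_prop) fun θ hθ => Or.inl (hpos θ hθ i).ne'
  simp_rw [← integral_mul_const]
  refine hasSum_integral_of_dominated_convergence
    (fun η θ => gapProd s a b θ * (∏ i, negBin s (θ i) (η i)) * ∏ i, Real.exp (h i * η i))
    (fun η => ?_) (fun η => ?_) ?_ ?_ ?_
  · exact (((measurable_gapProd s a b N).mul (Finset.measurable_fun_prod _ fun i _ =>
      (measurable_negBin s (η i)).comp (measurable_pi_apply i))).mul_const _).aestronglyMeasurable
  · filter_upwards [hmem] with θ hθ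
    refine (Real.norm_of_nonneg (mul_nonneg (mul_nonneg (gapProd_nonneg s hab.le hθ) ?_) ?_)).le
    · exact Finset.prod_nonneg fun i _ => negBin_nonneg hs (ha.trans (hθ.2 i).1) _
    · positivity
  · exact hmem.mono fun θ hθ => (hterm θ hθ).summable
  · exact hint.congr (hmem.mono fun θ hθ => (hterm θ hθ).tsum_eq.symm)
  · exact hmem.mono hterm

end MixtureMeasureMGF

/-- The moment generating function of the mixture measure: for `h_i < log(1+1/ρ_r)`, the series
`Σ_η μ_{N,ρ_l,ρ_r}(η) ∏_i e^{h_i η_i}` converges absolutely and equals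
`[Γ(2s(N+1))/(Γ(2s)^{N+1}(ρ_r−ρ_l)^{2s(N+1)−1})] ·
∫ over the ordered simplex of ∏_{i=1}^{N+1}(θ_i−θ_{i−1})^{2s−1}·∏_{i=1}^{N}(1+θ_i(1−e^{h_i}))^{−2s}`. -/
theorem mgf_mixtureMeasure (s : ℝ) (hs : 0 < s) (N : ℕ) (ρl ρr : ℝ)
    (h0 : 0 ≤ ρl) (hlr : ρl < ρr) (h : Fin N → ℝ)
    (hh : ∀ i, h i < Real.log (1 + 1 / ρr)) :
    Summable (fun η : Fin N → ℕ =>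
        mixtureMeasure s ρl ρr N η * ∏ i : Fin N, Real.exp (h i * (η i : ℝ))) ∧
    ∑' η : Fin N → ℕ,
        mixtureMeasure s ρl ρr N η * ∏ i : Fin N, Real.exp (h i * (η i : ℝ))
      = (Real.Gamma (2 * s * ((N : ℝ) + 1)) /
            (Real.Gamma (2 * s) ^ (N + 1) * (ρr - ρl) ^ (2 * s * ((N : ℝ) + 1) - 1))) *
          ∫ θ in simplexSet N ρl ρr,
            gapProd s ρl ρr θ *
              ∏ i : Fin N, (1 + θ i * (1 - Real.exp (h i))) ^ (-(2 * s)) := by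
  have hsum := (hasSum_setIntegral_gapProd_mul_negBin hs h0 hlr hh).mul_left
    (Real.Gamma (2 * s * ((N : ℝ) + 1)) /
      (Real.Gamma (2 * s) ^ (N + 1) * (ρr - ρl) ^ (2 * s * ((N : ℝ) + 1) - 1)))
  simp only [← mul_assoc] at hsum
  simp only [mixtureMeasure]
  exact ⟨hsum.summable, hsum.tsum_eq⟩
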